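/- arXiv:2007.00270 — 2 statements merged into one kernel-verified Lean document; each statement's English description precedes it below -/
import Mathlib

section
/- The quadratic polynomial a^2 + ab + b^2 + c^2 + a + b + c represents every nonnegative integer as a, b, c range over the integers. -/
/-- The ternary quadratic form with coefficients `A, B, C` on the squares and `r, s, t` on
`y * z`, `x * z`, `x * y`. -/
def ternaryForm (A B C r s t x y z : ℤ) : ℤ :=
  A * x ^ 2 + B * y ^ 2 + C * z ^ 2 + r * (y * z) + s * (x * z) + t * (x * y)

/-- Half the determinant of the Hessian matrix of `ternaryForm`. -/
def ternaryHalfDisc (A B C r s t : ℤ) : ℤ :=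
  4 * A * B * C + r * s * t - A * r ^ 2 - B * s ^ 2 - C * t ^ 2

theorem exists_abs_two_mul_add_mul_le (e : ℤ) {n : ℤ} (hn : 0 < n) :
    ∃ k : ℤ, |2 * (e + n * k)| ≤ n := by
  refine ⟨-((2 * e + n) / (2 * n)), ?_⟩
  have h1 := Int.mul_ediv_add_emod (2 * e + n) (2 * n)
  have h2 := Int.emod_nonneg (2 * e + n) (b := 2 * n) (by lia)
  have h3 := Int.emod_lt_of_pos (2 * e + n) (b := 2 * n) (by lia)
  rw [abs_le]
  constructor <;> linarith

theorem eq_one_of_reduced {A B D E F t : ℤ} (hA : 0 < A) (ht : |t| ≤ A) (hAB : A ≤ B)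
    (hD : D = 4 * A * B - t ^ 2) (hE : |2 * E| ≤ D) (hDF : D ≤ F)
    (hdisc : D * F - E ^ 2 = 12 * A) : A = 1 ∧ D ≤ 4 := by
  have ht2 : t ^ 2 ≤ A ^ 2 := sq_le_sq' (abs_le.1 ht).1 (abs_le.1 ht).2
  have hE2 : (2 * E) ^ 2 ≤ D ^ 2 := sq_le_sq' (abs_le.1 hE).1 (abs_le.1 hE).2
  have hDA : 3 * A ^ 2 ≤ D := by nlinarith
  have hD0 : 0 < D := by nlinarith
  have hD2 : D ^ 2 ≤ 16 * A := by nlinarith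
  have hA1 : A = 1 := by
    by_contra hne
    have hA2 : 2 ≤ A := by lia
    have h4 : (3 * A ^ 2) ^ 2 ≤ D ^ 2 := pow_le_pow_left₀ (by positivity) hDA 2
    have h5 : 9 * A ^ 3 ≤ 16 := by
      by_contra! h
      nlinarith
    nlinarith [pow_le_pow_left₀ (by norm_num) hA2 3]
  subst hA1
  exact ⟨rfl, by nlinarith⟩

theorem ternaryForm_represented_of_reduced {B C r s t : ℤ} (ht : |t| ≤ 1) (hs : |s| ≤ 1)
    (hB : 1 ≤ B) (hD : 4 * B - t ^ 2 ≤ 4) (hE : |2 * (2 * r - t * s)| ≤ 4 * B - t ^ 2)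
    (hdisc : ternaryHalfDisc 1 B C r s t = 3) (x y z : ℤ) :
    ∃ a b c : ℤ, ternaryForm 1 B C r s t x y z = a ^ 2 + a * b + b ^ 2 + c ^ 2 := by
  unfold ternaryHalfDisc at hdisc
  unfold ternaryForm
  rw [abs_le] at ht hs hE
  obtain ⟨ht1, ht2⟩ := ht
  obtain ⟨hs1, hs2⟩ := hs
  obtain ⟨hE1, hE2⟩ := hE
  have hB1 : B = 1 := by nlinarith
  subst hB1
  have hr1 : -1 ≤ r := by nlinarith
  have hr2 : r ≤ 1 := by nlinarith
  interval_cases t <;> interval_cases s <;> interval_cases r <;> first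
    | (exfalso; lia)
    | (obtain rfl : C = 1 := by lia
       first
       | exact ⟨x, y, z, by ring1⟩
       | exact ⟨x, -y, z, by ring1⟩
       | exact ⟨x, z, y, by ring1⟩
       | exact ⟨x, -z, y, by ring1⟩
       | exact ⟨y, z, x, by ring1⟩
       | exact ⟨y, -z, x, by ring1⟩)

/-- A positive definite integral ternary quadratic form of half-discriminant `3` only takes values
of the form `a ^ 2 + a * b + b ^ 2 + c ^ 2`. -/
theorem ternaryForm_represented (A B C r s t : ℤ) (hA : 0 < A) (hD : 0 < 4 * A * B - t ^ 2)
    (hdisc : ternaryHalfDisc A B C r s t = 3) (x y z : ℤ) :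
    ∃ a b c : ℤ, ternaryForm A B C r s t x y z = a ^ 2 + a * b + b ^ 2 + c ^ 2 := by
  obtain ⟨k, hk⟩ := exists_abs_two_mul_add_mul_le t (n := 2 * A) (by lia)
  obtain ⟨t', ht'⟩ : ∃ t', t' = t + 2 * A * k := ⟨_, rfl⟩
  obtain ⟨B', hB'⟩ : ∃ B', B' = A * k ^ 2 + t * k + B := ⟨_, rfl⟩
  obtain ⟨r', hr'⟩ : ∃ r', r' = r + s * k := ⟨_, rfl⟩
  have hDeq : 4 * A * B' - t' ^ 2 = 4 * A * B - t ^ 2 := by subst ht' hB'; ring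
  have hdisc' : ternaryHalfDisc A B' C r' s t' = 3 := by
    rw [← hdisc]; subst ht' hB' hr'; unfold ternaryHalfDisc; ring
  have hform : ternaryForm A B C r s t x y z = ternaryForm A B' C r' s t' (x - k * y) y z := by
    subst ht' hB' hr'; unfold ternaryForm; ring
  have ht : |t'| ≤ A := by
    rw [← ht', abs_le] at hk
    rw [abs_le]; constructor <;> linarith
  have hB'0 : 0 < B' := by
    by_contra! h
    nlinarith [sq_nonneg t']
  rw [hform]
  rcases lt_or_ge B' A with hBA | hAB
  · obtain ⟨a, b, c, h⟩ := ternaryForm_represented B' A C s r' t' hB'0 (by linarith)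
      (by rw [← hdisc']; unfold ternaryHalfDisc; ring) y (x - k * y) z
    exact ⟨a, b, c, by rw [← h]; unfold ternaryForm; ring⟩
  obtain ⟨D, hDdef⟩ : ∃ D, D = 4 * A * B' - t' ^ 2 := ⟨_, rfl⟩
  have hD0 : 0 < D := by linarith
  obtain ⟨l, hl⟩ := exists_abs_two_mul_add_mul_le (2 * A * r' - t' * s) hD0
  obtain ⟨C₁, hC₁⟩ : ∃ C₁, C₁ = B' * l ^ 2 + r' * l + C := ⟨_, rfl⟩
  obtain ⟨r₁, hr₁⟩ : ∃ r₁, r₁ = r' + 2 * B' * l := ⟨_, rfl⟩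
  obtain ⟨s₁, hs₁⟩ : ∃ s₁, s₁ = s + t' * l := ⟨_, rfl⟩
  obtain ⟨j, hj⟩ := exists_abs_two_mul_add_mul_le s₁ (n := 2 * A) (by lia)
  obtain ⟨C₂, hC₂⟩ : ∃ C₂, C₂ = A * j ^ 2 + s₁ * j + C₁ := ⟨_, rfl⟩
  obtain ⟨r₂, hr₂⟩ : ∃ r₂, r₂ = r₁ + t' * j := ⟨_, rfl⟩
  obtain ⟨s₂, hs₂⟩ : ∃ s₂, s₂ = s₁ + 2 * A * j := ⟨_, rfl⟩
  have hE : |2 * (2 * A * r₂ - t' * s₂)| ≤ D := by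
    convert hl using 2
    subst hDdef hr₂ hs₂ hr₁ hs₁; ring
  have hdisc₂ : ternaryHalfDisc A B' C₂ r₂ s₂ t' = 3 := by
    rw [← hdisc']; subst hC₂ hr₂ hs₂ hC₁ hr₁ hs₁; unfold ternaryHalfDisc; ring
  have hform₂ : ternaryForm A B' C r' s t' (x - k * y) y z =
      ternaryForm A B' C₂ r₂ s₂ t' (x - k * y - j * z) (y - l * z) z := by
    subst hC₂ hr₂ hs₂ hC₁ hr₁ hs₁; unfold ternaryForm; ring
  have hs : |s₂| ≤ A := by
    rw [← hs₂, abs_le] at hj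
    rw [abs_le]; constructor <;> linarith
  have hDF : D * (4 * A * C₂ - s₂ ^ 2) - (2 * A * r₂ - t' * s₂) ^ 2 = 12 * A := by
    have : 12 * A = 4 * A * ternaryHalfDisc A B' C₂ r₂ s₂ t' := by rw [hdisc₂]; ring
    rw [this, hDdef]; unfold ternaryHalfDisc; ring
  rw [hform₂]
  rcases lt_or_ge (4 * A * C₂ - s₂ ^ 2) D with hFD | hFD
  · have hF0 : 0 < 4 * A * C₂ - s₂ ^ 2 := by
      by_contra! h
      nlinarith [sq_nonneg (2 * A * r₂ - t' * s₂)]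
    obtain ⟨a, b, c, h⟩ := ternaryForm_represented A C₂ B' r₂ t' s₂ hA hF0
      (by rw [← hdisc₂]; unfold ternaryHalfDisc; ring) (x - k * y - j * z) z (y - l * z)
    exact ⟨a, b, c, by rw [← h]; unfold ternaryForm; ring⟩
  · obtain ⟨rfl, hD4⟩ := eq_one_of_reduced hA ht hAB hDdef hE hFD hDF
    refine ternaryForm_represented_of_reduced ht hs hAB (by linarith) ?_ hdisc₂ _ _ _
    convert hE using 1
    · ring_nf
    · rw [hDdef]; ring
termination_by (A.toNat, (4 * A * B - t ^ 2).toNat)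
decreasing_by
  · exact Prod.Lex.left _ _ (by lia)
  · exact Prod.Lex.right _ (by lia)

/-- If `N ≡ 7 [MOD 12]` and `p` is a prime with `p ≡ 1 [MOD 4]` and `N ∣ 3 * p + 1`, then `N` is a
quadratic residue modulo `p`. -/
theorem jacobiSym_eq_one_of_dvd_three_mul_add_one {N p : ℕ} (hN : N % 12 = 7) (hp : p % 4 = 1)
    (hdvd : N ∣ 3 * p + 1) : jacobiSym N p = 1 := by
  have hNodd : Odd N := Nat.odd_iff.2 (by lia)
  have hpodd : Odd p := Nat.odd_iff.2 (by lia)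
  have h1 : jacobiSym ((3 : ℕ) * (p : ℤ)) N = -1 := by
    have : jacobiSym ((3 : ℕ) * (p : ℤ)) N = jacobiSym (-1) N := by
      apply jacobiSym.mod_left'
      apply Int.ModEq.symm
      rw [Int.modEq_iff_dvd]
      have := Int.natCast_dvd_natCast.2 hdvd
      push_cast at this ⊢
      simpa using this
    rw [this, jacobiSym.at_neg_one hNodd, ZMod.χ₄_nat_three_mod_four (by lia)]
  have h2 : jacobiSym (3 : ℕ) N = -1 := by
    rw [jacobiSym.quadratic_reciprocity_three_mod_four (by norm_num) (by lia),
      jacobiSym.mod_left, show (N : ℤ) % (3 : ℕ) = 1 by lia, jacobiSym.one_left]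
  rw [jacobiSym.mul_left, h2] at h1
  rw [jacobiSym.quadratic_reciprocity_one_mod_four' hNodd hp]
  linarith

theorem exists_sq_add_dvd {N p d : ℕ} [hp : Fact p.Prime] (hp4 : p % 4 = 1)
    (hN : jacobiSym N p = 1) (hd : 3 * p + 1 = 4 * N * d) :
    ∃ t : ℤ, (p : ℤ) ∣ d + t ^ 2 := by
  obtain ⟨w, hw⟩ := ZMod.isSquare_of_jacobiSym_eq_one hN
  obtain ⟨i, hi⟩ := (ZMod.exists_sq_eq_neg_one_iff (p := p)).2 (by lia)
  have hd' : (1 : ZMod p) = 4 * (w * w) * d := by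
    have := congrArg (Nat.cast : ℕ → ZMod p) hd
    push_cast at this
    rw [CharP.cast_eq_zero, ← Int.cast_natCast N, hw] at this
    linear_combination this
  refine ⟨((i * (2 * w * d) : ZMod p)).val, ?_⟩
  rw [← ZMod.intCast_zmod_eq_zero_iff_dvd]
  push_cast
  rw [ZMod.natCast_zmod_val]
  linear_combination (-4 * w ^ 2 * d ^ 2) * hi + (d : ZMod p) * hd'

theorem exists_three_mul_eq (m : ℕ) :
    ∃ a b c : ℤ, 3 * (12 * m + 7 : ℤ) = a ^ 2 + a * b + b ^ 2 + c ^ 2 := by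
  have hcop : (16 * m + 9).Coprime (4 * (12 * m + 7)) := by
    rw [← Nat.isCoprime_iff_coprime]
    exact ⟨-3, 1, by push_cast; ring⟩
  obtain ⟨p, hlt, hp, hmod⟩ := Nat.forall_exists_prime_gt_and_modEq (16 * m + 9) (by lia) hcop
  obtain ⟨j, hj⟩ := (Nat.modEq_iff_dvd' hlt.le).1 hmod.symm
  have hpj : p = 16 * m + 9 + 4 * (12 * m + 7) * j := by lia
  have hd : 3 * p + 1 = 4 * (12 * m + 7) * (3 * j + 1) := by rw [hpj]; ring
  have hp4 : p % 4 = 1 := by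
    rw [hpj, mul_assoc]; lia
  have : Fact p.Prime := ⟨hp⟩
  have hJ := jacobiSym_eq_one_of_dvd_three_mul_add_one (N := 12 * m + 7) (by lia) hp4
    ⟨4 * (3 * j + 1), by rw [hd]; ring⟩
  obtain ⟨t, B, hB⟩ := exists_sq_add_dvd hp4 hJ hd
  have hdZ : 3 * (p : ℤ) + 1 = 4 * (12 * m + 7) * (3 * j + 1) := by exact_mod_cast hd
  push_cast at hB
  obtain ⟨a, b, c, h⟩ := ternaryForm_represented p B (3 * (12 * m + 7)) 3 0 (2 * t)
    (by exact_mod_cast hp.pos) (by nlinarith)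
    (by unfold ternaryHalfDisc; linear_combination -12 * (12 * m + 7 : ℤ) * hB - 3 * hdZ) 0 0 1
  exact ⟨a, b, c, by rw [← h]; unfold ternaryForm; ring⟩

theorem exists_sq_add_three_mul_sq (a b : ℤ) :
    ∃ x y : ℤ, a ^ 2 + a * b + b ^ 2 = x ^ 2 + 3 * y ^ 2 := by
  rcases Int.even_or_odd' b with ⟨k, rfl | rfl⟩
  · exact ⟨a + k, k, by ring⟩
  rcases Int.even_or_odd' a with ⟨l, rfl | rfl⟩
  · exact ⟨2 * k + 1 + l, l, by ring⟩
  · exact ⟨k - l, k + l + 1, by ring⟩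

theorem three_dvd_of_three_dvd_sq_add_sq {x z : ℤ} (h : 3 ∣ x ^ 2 + z ^ 2) : 3 ∣ x ∧ 3 ∣ z := by
  have h0 : (x ^ 2 + z ^ 2) % 3 = 0 := Int.emod_eq_zero_of_dvd h
  have hx : x % 3 = 0 ∨ x % 3 = 1 ∨ x % 3 = 2 := by lia
  have hz : z % 3 = 0 ∨ z % 3 = 1 ∨ z % 3 = 2 := by lia
  rcases hx with hx | hx | hx <;> rcases hz with hz | hz | hz <;>
    simp [pow_two, Int.add_emod, Int.mul_emod, hx, hz] at h0
  lia

theorem exists_eq_sq_add_three_mul_sq_add_three_mul_sq (m : ℕ) :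
    ∃ x y z : ℤ, (12 * m + 7 : ℤ) = y ^ 2 + 3 * x ^ 2 + 3 * z ^ 2 := by
  obtain ⟨a, b, c, h⟩ := exists_three_mul_eq m
  obtain ⟨x, y, hxy⟩ := exists_sq_add_three_mul_sq a b
  rw [hxy] at h
  obtain ⟨⟨x', rfl⟩, ⟨c', rfl⟩⟩ := three_dvd_of_three_dvd_sq_add_sq (x := x) (z := c)
    ⟨12 * m + 7 - y ^ 2, by linarith⟩
  exact ⟨x', y, c', by linarith⟩

theorem exists_eq_of_odd {m x y z : ℤ} (h : 12 * m + 7 = y ^ 2 + 3 * x ^ 2 + 3 * z ^ 2)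
    (hz : Odd z) : ∃ a b c : ℤ, a ^ 2 + a * b + b ^ 2 + c ^ 2 + a + b + c = m := by
  obtain ⟨c, rfl⟩ := hz
  obtain ⟨b, hb⟩ : ∃ b, y ^ 2 = (3 * b + 1) ^ 2 := by
    have hy : y % 3 = 0 ∨ y % 3 = 1 ∨ y % 3 = 2 := by lia
    rcases hy with hy | hy | hy
    · obtain ⟨k, rfl⟩ := Int.dvd_of_emod_eq_zero hy
      ring_nf at h
      lia
    · exact ⟨y / 3, by congr 1; lia⟩
    · exact ⟨-(y / 3) - 1, by rw [← neg_sq y]; congr 1; lia⟩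
  rw [hb] at h
  obtain ⟨a, ha⟩ : ∃ a, x = 2 * a + b + 1 := by
    rcases Int.even_or_odd' x with ⟨k, rfl | rfl⟩ <;>
      rcases Int.even_or_odd' b with ⟨l, rfl | rfl⟩
    · ring_nf at h
      lia
    · exact ⟨k - l - 1, by ring⟩
    · exact ⟨k - l, by ring⟩
    · ring_nf at h
      lia
  subst ha
  exact ⟨a, b, c, by linarith⟩

theorem universal_qp1 (m : ℕ) :
    ∃ a b c : ℤ, a ^ 2 + a * b + b ^ 2 + c ^ 2 + a + b + c = m := by
  obtain ⟨x, y, z, h⟩ := exists_eq_sq_add_three_mul_sq_add_three_mul_sq m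
  rcases Int.even_or_odd' z with ⟨k, hz | hz⟩
  · rcases Int.even_or_odd' x with ⟨l, hx | hx⟩
    · rcases Int.even_or_odd' y with ⟨n, rfl | rfl⟩ <;> (subst hx hz; ring_nf at h; lia)
    · exact exists_eq_of_odd (x := z) (y := y) (by linarith) ⟨l, hx⟩
  · exact exists_eq_of_odd h ⟨k, hz⟩
end

section
/- The quadratic form a^2 + b^2 + c^2 + d^2 + (a+b+c+d)^2 in integer variables a, b, c, d represents exactly the nonnegative even integers; equivalently, the form a^2 + b^2 + c^2 + d^2 + ab + ac + ad + bc + bd + cd represents all nonnegative integers. -/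
open scoped NumberTheorySymbols

/-- Rounding: every integer is within half of `Z` of a multiple of `Z`. -/
theorem exists_four_mul_sub_mul_sq_le {Z : ℤ} (hZ : 0 < Z) (x : ℤ) :
    ∃ y : ℤ, 4 * (x - Z * y) ^ 2 ≤ Z ^ 2 := by
  refine ⟨(2 * x + Z) / (2 * Z), ?_⟩
  have h1 := Int.emod_add_mul_ediv (2 * x + Z) (2 * Z)
  have h2 := Int.emod_nonneg (2 * x + Z) (b := 2 * Z) (by lia)
  have h3 := Int.emod_lt_of_pos (2 * x + Z) (b := 2 * Z) (by lia)
  set y := (2 * x + Z) / (2 * Z)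
  have h4 : -Z ≤ 2 * (x - Z * y) := by linarith
  have h5 : 2 * (x - Z * y) ≤ Z := by linarith
  nlinarith

/-- The **Davenport–Cassels** descent for sums of three squares. -/
theorem sum_three_squares_of_mul_sq {n : ℤ} (Z : ℕ) (hZ : 0 < Z) (x₁ x₂ x₃ : ℤ)
    (h : n * (Z : ℤ) ^ 2 = x₁ ^ 2 + x₂ ^ 2 + x₃ ^ 2) :
    ∃ y₁ y₂ y₃ : ℤ, n = y₁ ^ 2 + y₂ ^ 2 + y₃ ^ 2 := by
  induction Z using Nat.strong_induction_on generalizing x₁ x₂ x₃ with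
  | _ Z ih =>
  have hZ' : (0 : ℤ) < Z := by exact_mod_cast hZ
  obtain ⟨y₁, h₁⟩ := exists_four_mul_sub_mul_sq_le hZ' x₁
  obtain ⟨y₂, h₂⟩ := exists_four_mul_sub_mul_sq_le hZ' x₂
  obtain ⟨y₃, h₃⟩ := exists_four_mul_sub_mul_sq_le hZ' x₃
  obtain ⟨a, ha⟩ : ∃ a, a = y₁ ^ 2 + y₂ ^ 2 + y₃ ^ 2 - n := ⟨_, rfl⟩
  obtain ⟨b, hb⟩ : ∃ b, b = 2 * (n * Z - (x₁ * y₁ + x₂ * y₂ + x₃ * y₃)) := ⟨_, rfl⟩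
  have key : (Z : ℤ) * (a * Z + b) =
      (x₁ - Z * y₁) ^ 2 + (x₂ - Z * y₂) ^ 2 + (x₃ - Z * y₃) ^ 2 := by
    subst ha hb
    linear_combination h
  have hnonneg : 0 ≤ a * Z + b := by
    by_contra! hneg
    nlinarith [sq_nonneg (x₁ - Z * y₁), sq_nonneg (x₂ - Z * y₂), sq_nonneg (x₃ - Z * y₃)]
  have hlt : a * Z + b < Z := by
    by_contra! hge
    nlinarith
  obtain ⟨W, hW⟩ := Int.eq_ofNat_of_zero_le hnonneg
  rcases Nat.eq_zero_or_pos W with rfl | hWpos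
  · refine ⟨y₁, y₂, y₃, ?_⟩
    rw [hW, Nat.cast_zero, mul_zero] at key
    have e₁ : x₁ = Z * y₁ := sub_eq_zero.mp <| sq_eq_zero_iff.mp <| by
      linarith [sq_nonneg (x₁ - Z * y₁), sq_nonneg (x₂ - Z * y₂), sq_nonneg (x₃ - Z * y₃)]
    have e₂ : x₂ = Z * y₂ := sub_eq_zero.mp <| sq_eq_zero_iff.mp <| by
      linarith [sq_nonneg (x₁ - Z * y₁), sq_nonneg (x₂ - Z * y₂), sq_nonneg (x₃ - Z * y₃)]
    have e₃ : x₃ = Z * y₃ := sub_eq_zero.mp <| sq_eq_zero_iff.mp <| by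
      linarith [sq_nonneg (x₁ - Z * y₁), sq_nonneg (x₂ - Z * y₂), sq_nonneg (x₃ - Z * y₃)]
    have hne : (Z : ℤ) ^ 2 ≠ 0 := by positivity
    apply mul_right_cancel₀ hne
    rw [h, e₁, e₂, e₃]
    ring
  · refine ih W (by lia) hWpos (a * x₁ + b * y₁) (a * x₂ + b * y₂) (a * x₃ + b * y₃) ?_
    rw [← hW]
    subst ha hb
    linear_combination (y₁ ^ 2 + y₂ ^ 2 + y₃ ^ 2 - n) ^ 2 * h

/-- Every `n ≡ 3 [MOD 8]` is a quadratic residue modulo some prime `p ≡ 1 [MOD 4]` with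
`n ∣ 2 * p + 1`. -/
theorem exists_prime_isSquare_of_mod_eight_eq_three {n : ℕ} (hn : n % 8 = 3) :
    ∃ p : ℕ, p.Prime ∧ p % 4 = 1 ∧ n ∣ 2 * p + 1 ∧ IsSquare ((n : ℤ) : ZMod p) := by
  obtain ⟨k, rfl⟩ : ∃ k, n = 8 * k + 3 := ⟨n / 8, by lia⟩
  have hcop : (4 * k + 1).Coprime (4 * (8 * k + 3)) := by
    apply Nat.Coprime.mul_right
    · rw [show 4 * k + 1 = 1 + 4 * k by ring]
      simp
    · rw [show 8 * k + 3 = 1 + (4 * k + 1) * 2 by ring]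
      simp
  obtain ⟨p, -, hp, hpk⟩ := Nat.forall_exists_prime_gt_and_modEq 0 (by lia) hcop
  have hp4 : p % 4 = 1 := by
    have := hpk.of_mul_right (8 * k + 3)
    unfold Nat.ModEq at this
    lia
  have hdvd : 8 * k + 3 ∣ 2 * p + 1 := by
    have h := ((hpk.of_mul_left 4).mul_left 2).add_right 1
    rw [show 2 * (4 * k + 1) + 1 = 8 * k + 3 by ring] at h
    exact (h.dvd_iff dvd_rfl).mpr dvd_rfl
  refine ⟨p, hp, hp4, hdvd, ?_⟩
  have : Fact p.Prime := ⟨hp⟩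
  have hodd : Odd (8 * k + 3) := ⟨4 * k + 1, by ring⟩
  apply ZMod.isSquare_of_jacobiSym_eq_one
  rw [← jacobiSym.quadratic_reciprocity_one_mod_four hp4 hodd]
  have h2 : J(-2 | 8 * k + 3) = 1 := by
    rw [jacobiSym.at_neg_two hodd, ZMod.χ₈'_nat_eq_if_mod_eight, if_neg (by lia),
      if_pos (by lia)]
  have h3 : J(-2 * p | 8 * k + 3) = 1 := by
    rw [← jacobiSym.one_left (8 * k + 3)]
    apply jacobiSym.mod_left'
    apply Int.ModEq.symm
    rw [Int.modEq_iff_dvd]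
    obtain ⟨c, hc⟩ := hdvd
    refine ⟨-c, ?_⟩
    have : (2 * p + 1 : ℤ) = (8 * k + 3) * c := by exact_mod_cast hc
    push_cast
    linarith
  rwa [jacobiSym.mul_left, h2, one_mul] at h3

/-- A pigeonhole argument in the spirit of Thue's lemma, for three simultaneous congruences. -/
theorem exists_small_solution {n p : ℕ} (hn : 0 < n) (hp : 0 < p) (s : ℤ) :
    ∃ w r z : ℤ, (w, r, z) ≠ 0 ∧ w ^ 2 ≤ 2 * p * n ∧ r ^ 2 ≤ n ∧ z ^ 2 ≤ 2 * p ∧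
      (n : ℤ) ∣ w - r ∧ (p : ℤ) ∣ w - s * z ∧ 2 ∣ w - z := by
  have : NeZero n := ⟨hn.ne'⟩
  have : NeZero p := ⟨hp.ne'⟩
  let S := Finset.range (Nat.sqrt (2 * p * n) + 1) ×ˢ
    Finset.range (Nat.sqrt n + 1) ×ˢ Finset.range (Nat.sqrt (2 * p) + 1)
  let f : ℕ × ℕ × ℕ → ZMod n × ZMod p × ZMod 2 := fun v =>
    (((v.1 - v.2.1 : ℤ) : ZMod n), ((v.1 - s * v.2.2 : ℤ) : ZMod p),
      ((v.1 - v.2.2 : ℤ) : ZMod 2))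
  have hcard : (Finset.univ : Finset (ZMod n × ZMod p × ZMod 2)).card < S.card := by
    have e₁ := Nat.lt_succ_sqrt' (2 * p * n)
    have e₂ := Nat.lt_succ_sqrt' n
    have e₃ := Nat.lt_succ_sqrt' (2 * p)
    simp only [S, Finset.card_product, Finset.card_range, Finset.card_univ, Fintype.card_prod,
      ZMod.card]
    apply lt_of_pow_lt_pow_left₀ 2 (Nat.zero_le _)
    calc (n * (p * 2)) ^ 2 = (2 * p * n) * (n * (2 * p)) := by ring
      _ < (Nat.sqrt (2 * p * n)).succ ^ 2 *
          ((Nat.sqrt n).succ ^ 2 * (Nat.sqrt (2 * p)).succ ^ 2) := by gcongr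
      _ = _ := by simp only [Nat.succ_eq_add_one]; ring
  obtain ⟨⟨w, r, z⟩, hv, ⟨w', r', z'⟩, hv', hne, hf⟩ :=
    Finset.exists_ne_map_eq_of_card_lt_of_maps_to hcard (f := f) (by intro x _; simp)
  have bound {N a b : ℕ} (ha : a < Nat.sqrt N + 1) (hb : b < Nat.sqrt N + 1) :
      ((a : ℤ) - b) ^ 2 ≤ N := by
    have h : ((Nat.sqrt N : ℕ) : ℤ) ^ 2 ≤ N := by exact_mod_cast Nat.sqrt_le' N
    refine le_trans (sq_le_sq' ?_ ?_) h <;> lia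
  simp only [S, Finset.mem_product, Finset.mem_range] at hv hv'
  simp only [f, Prod.mk.injEq, ZMod.intCast_eq_intCast_iff_dvd_sub] at hf
  refine ⟨w' - w, r' - r, z' - z, ?_, ?_, bound hv'.2.1 hv.2.1, ?_, ?_, ?_, ?_⟩
  · intro h
    apply hne
    simp only [Prod.mk_eq_zero] at h
    simp only [Prod.mk.injEq]
    lia
  · exact_mod_cast bound hv'.1 hv.1
  · exact_mod_cast bound hv'.2.2 hv.2.2
  · convert hf.1 using 1; ring
  · convert hf.2.1 using 1; ring
  · convert hf.2.2 using 1; push_cast; ring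

theorem exists_mul_sq_eq_sq_add_two_mul_prime_mul_sq {n p : ℕ} (hn : n % 8 = 3)
    (hp : p.Prime) (hp4 : p % 4 = 1) (hnp : n ∣ 2 * p + 1)
    (hsq : IsSquare ((n : ℤ) : ZMod p)) :
    ∃ w r z : ℤ, z ≠ 0 ∧ n * z ^ 2 = w ^ 2 + 2 * p * r ^ 2 := by
  obtain ⟨s', hs'⟩ := hsq
  obtain ⟨s, rfl⟩ := ZMod.intCast_surjective s'
  have hs : (p : ℤ) ∣ s * s - n := by
    rw [← ZMod.intCast_eq_intCast_iff_dvd_sub]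
    exact_mod_cast hs'
  obtain ⟨c, hc⟩ : (n : ℤ) ∣ 2 * p + 1 := by exact_mod_cast hnp
  have hn0 : (0 : ℤ) < n := by lia
  have hp0 : (0 : ℤ) < p := by exact_mod_cast hp.pos
  obtain ⟨w, r, z, hne, hw, hr, hz, hwr, hwz, hwz2⟩ :=
    exists_small_solution (n := n) (p := p) (by lia) hp.pos s
  obtain ⟨F, hF⟩ : ∃ F, F = w ^ 2 + 2 * p * r ^ 2 - n * z ^ 2 := ⟨_, rfl⟩
  have hFn : (n : ℤ) ∣ F := by
    obtain ⟨u, hu⟩ := hwr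
    refine ⟨u * (w + r) + c * r ^ 2 - z ^ 2, ?_⟩
    rw [hF]
    linear_combination (w + r) * hu + r ^ 2 * hc
  have hFp : (p : ℤ) ∣ F := by
    obtain ⟨u, hu⟩ := hwz
    obtain ⟨v, hv⟩ := hs
    refine ⟨u * (w + s * z) + v * z ^ 2 + 2 * r ^ 2, ?_⟩
    rw [hF]
    linear_combination (w + s * z) * hu + z ^ 2 * hv
  have hF2 : (2 : ℤ) ∣ F := by
    obtain ⟨u, hu⟩ := hwz2
    obtain ⟨k, hk⟩ : ∃ k : ℤ, (n : ℤ) = 2 * k + 1 := ⟨n / 2, by lia⟩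
    refine ⟨u * (w + z) + p * r ^ 2 - k * z ^ 2, ?_⟩
    rw [hF]
    linear_combination (w + z) * hu - z ^ 2 * hk
  have hcop : IsCoprime (n : ℤ) (2 * p) := ⟨c, -1, by linarith⟩
  have hcop2 : IsCoprime (2 : ℤ) p := by
    refine ⟨-((p : ℤ) / 2), 1, ?_⟩
    lia
  obtain ⟨t, ht⟩ := hcop.mul_dvd hFn (hcop2.mul_dvd hF2 hFp)
  have hnsq (a : ℤ) : a ^ 2 ≠ n := by
    intro h
    have h8 : a ^ 2 % 8 = 3 := by lia
    have : a % 8 = 0 ∨ a % 8 = 1 ∨ a % 8 = 2 ∨ a % 8 = 3 ∨ a % 8 = 4 ∨ a % 8 = 5 ∨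
      a % 8 = 6 ∨ a % 8 = 7 := by lia
    rcases this with h | h | h | h | h | h | h | h <;> simp [pow_two, Int.mul_emod, h] at h8
  have hpsq (a : ℤ) : a ^ 2 ≠ 2 * p := by
    intro h
    have h4 : a ^ 2 % 4 = 2 := by lia
    have : a % 4 = 0 ∨ a % 4 = 1 ∨ a % 4 = 2 ∨ a % 4 = 3 := by lia
    rcases this with h | h | h | h <;> simp [pow_two, Int.mul_emod, h] at h4
  have hr' : r ^ 2 < n := lt_of_le_of_ne hr (hnsq r)
  have hz' : z ^ 2 < 2 * p := lt_of_le_of_ne hz (hpsq z)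
  have hpn : (0 : ℤ) < n * (2 * p) := by positivity
  have hlower : -(n * (2 * p)) < F := by
    have := mul_lt_mul_of_pos_left hz' hn0
    nlinarith [sq_nonneg w, mul_nonneg hp0.le (sq_nonneg r)]
  have hupper : F < 2 * (n * (2 * p)) := by
    have := mul_lt_mul_of_pos_left hr' hp0
    nlinarith [mul_nonneg hn0.le (sq_nonneg z)]
  have ht0 : t = 0 ∨ t = 1 := by
    have h1 : -1 < t := by
      by_contra! h
      nlinarith
    have h2 : t < 2 := by
      by_contra! h
      nlinarith
    lia
  rcases ht0 with rfl | rfl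
  · refine ⟨w, r, z, ?_, by linarith⟩
    rintro rfl
    have e : w ^ 2 + 2 * p * r ^ 2 = 0 := by linarith
    have hr0 : r = 0 := by
      by_contra h
      have : 0 < r ^ 2 := by positivity
      nlinarith [sq_nonneg w, mul_pos hp0 this]
    subst hr0
    have hw0 : w = 0 := by simpa using e
    subst hw0
    exact hne rfl
  · refine ⟨w * z + 2 * p * r, w - r * z, z ^ 2 + 2 * p, by positivity, ?_⟩
    have e : w ^ 2 + 2 * p * r ^ 2 = n * (z ^ 2 + 2 * p) := by linarith
    linear_combination -(z ^ 2 + 2 * p) * e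

/-- **Gauss**: every natural number congruent to `3` modulo `8` is a sum of three squares. -/
theorem sum_three_squares_of_mod_eight_eq_three {n : ℕ} (hn : n % 8 = 3) :
    ∃ x y z : ℤ, (n : ℤ) = x ^ 2 + y ^ 2 + z ^ 2 := by
  obtain ⟨p, hp, hp4, hnp, hsq⟩ := exists_prime_isSquare_of_mod_eight_eq_three hn
  obtain ⟨w, r, z, hz, h⟩ :=
    exists_mul_sq_eq_sq_add_two_mul_prime_mul_sq hn hp hp4 hnp hsq
  have : Fact p.Prime := ⟨hp⟩
  obtain ⟨a, b, hab⟩ := Nat.Prime.sq_add_sq (p := p) (by lia)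
  have hab' : (a : ℤ) ^ 2 + (b : ℤ) ^ 2 = p := by exact_mod_cast hab
  apply sum_three_squares_of_mul_sq z.natAbs (Int.natAbs_pos.mpr hz) w ((a + b) * r)
    ((a - b) * r)
  rw [Int.natCast_natAbs, sq_abs, h]
  linear_combination -2 * r ^ 2 * hab'

theorem exists_A4_form_eq_two_mul (m : ℕ) : ∃ a b c d : ℤ,
    a ^ 2 + b ^ 2 + c ^ 2 + d ^ 2 + (a + b + c + d) ^ 2 = 2 * m := by
  rcases Nat.eq_zero_or_pos m with rfl | hm
  · exact ⟨0, 0, 0, 0, by simp⟩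
  obtain ⟨x, y, z, h⟩ := sum_three_squares_of_mod_eight_eq_three (n := 8 * m - 5) (by lia)
  have h' : x ^ 2 + y ^ 2 + z ^ 2 = 8 * m - 5 := by
    rw [← h]
    lia
  have hsq (a : ℤ) : (a % 2 = 1 ∧ a ^ 2 % 4 = 1) ∨ (a % 2 = 0 ∧ a ^ 2 % 4 = 0) := by
    rcases Int.even_or_odd a with ⟨k, rfl⟩ | ha
    · right
      ring_nf
      lia
    · exact .inl ⟨Int.odd_iff.mp ha, Int.sq_mod_four_eq_one_of_odd ha⟩
  have hodd : x % 2 = 1 ∧ y % 2 = 1 ∧ z % 2 = 1 := by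
    have hx := hsq x
    have hy := hsq y
    have hz := hsq z
    lia
  obtain ⟨x, a, hx, h', ha⟩ : ∃ x' a : ℤ, x' % 2 = 1 ∧
      x' ^ 2 + y ^ 2 + z ^ 2 = 8 * m - 5 ∧ 1 + x' + y + z = 4 * a := by
    rcases Int.emod_two_eq_zero_or_one ((1 + x + y + z) / 2) with h4 | h4
    · exact ⟨x, (1 + x + y + z) / 4, hodd.1, h', by lia⟩
    · exact ⟨-x, (1 - x + y + z) / 4, by lia, by rw [neg_sq, h'], by lia⟩
  obtain ⟨u, hu⟩ : ∃ u, y + z = 2 * u := ⟨(y + z) / 2, by lia⟩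
  obtain ⟨v, hv⟩ : ∃ v, x + z = 2 * v := ⟨(x + z) / 2, by lia⟩
  obtain ⟨t, ht⟩ : ∃ t, x + y = 2 * t := ⟨(x + y) / 2, by lia⟩
  refine ⟨a, a - u, a - v, a - t, ?_⟩
  obtain rfl : x = v + t - u := by linarith
  obtain rfl : y = u + t - v := by linarith
  obtain rfl : z = u + v - t := by linarith
  have hs : u + v + t = 4 * a - 1 := by linarith
  obtain rfl : t = 4 * a - 1 - u - v := by linarith
  linarith

theorem A4_form_represents :
    ({n : ℤ | ∃ a b c d : ℤ,
        a ^ 2 + b ^ 2 + c ^ 2 + d ^ 2 + (a + b + c + d) ^ 2 = n}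
      = {n : ℤ | 0 ≤ n ∧ Even n}) ∧
    ∀ m : ℕ, ∃ a b c d : ℤ,
      a ^ 2 + b ^ 2 + c ^ 2 + d ^ 2 + a * b + a * c + a * d + b * c + b * d + c * d = m := by
  constructor
  · ext n
    simp only [Set.mem_ofPred_eq]
    constructor
    · rintro ⟨a, b, c, d, rfl⟩
      exact ⟨by positivity,
        a ^ 2 + b ^ 2 + c ^ 2 + d ^ 2 + a * b + a * c + a * d + b * c + b * d + c * d, by ring⟩
    · rintro ⟨h0, k, rfl⟩
      obtain ⟨m, rfl⟩ := Int.eq_ofNat_of_zero_le (show 0 ≤ k by lia)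
      obtain ⟨a, b, c, d, h⟩ := exists_A4_form_eq_two_mul m
      exact ⟨a, b, c, d, by rw [h]; ring⟩
  · intro m
    obtain ⟨a, b, c, d, h⟩ := exists_A4_form_eq_two_mul m
    exact ⟨a, b, c, d, by linarith⟩
end
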